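/- Let f : ℝ → ℝ be three times continuously differentiable with f(θ) + f''(θ) > 0 for all θ ∈ [0,π]. Define θ(p) = arccos(−p/√(1+p²)) ∈ (0,π) and W(p) = √(1+p²) · f(θ(p)) for p ∈ ℝ. Then there exist constants c₁, c₂, c₃ > 0 such that for all p ∈ ℝ: c₁/(1+p²) ≤ √(1+p²) W''(p) ≤ c₂/(1+p²), and √(1+p²) |W'''(p)| ≤ c₃/(1+p²)^{3/2}. -/

import Mathlib

theorem Real.arccos_neg_div_sqrt_one_add_sq (p : ℝ) :
    Real.arccos (-p / Real.sqrt (1 + p ^ 2)) = Real.arctan p + Real.pi / 2 := by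
  rw [neg_div, Real.arccos_neg, Real.arccos_eq_pi_div_two_sub_arcsin, Real.arctan_eq_arcsin]
  ring

theorem hasDerivAt_sqrt_one_add_sq (p : ℝ) :
    HasDerivAt (fun x : ℝ => Real.sqrt (1 + x ^ 2)) (p / Real.sqrt (1 + p ^ 2)) p := by
  have h : HasDerivAt (fun x : ℝ => 1 + x ^ 2) (2 * p) p := by
    simpa using (hasDerivAt_pow 2 p).const_add 1
  convert h.sqrt (by positivity) using 1
  field_simp

theorem hasDerivAt_comp_arctan_add_pi_div_two {g : ℝ → ℝ} {g' p : ℝ}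
    (hg : HasDerivAt g g' (Real.arctan p + Real.pi / 2)) :
    HasDerivAt (fun x => g (Real.arctan x + Real.pi / 2)) (g' / Real.sqrt (1 + p ^ 2) ^ 2) p := by
  have h : HasDerivAt (fun x => g (Real.arctan x + Real.pi / 2)) (g' * (1 / (1 + p ^ 2))) p :=
    hg.comp p ((Real.hasDerivAt_arctan p).add_const (Real.pi / 2))
  rw [Real.sq_sqrt (by positivity)]
  rwa [mul_one_div] at h

/-- Growth conditions for a strictly stable interfacial energy: if `f + f'' > 0` on `[0,π]`
and `W(p) = √(1+p²) f(θ(p))` with `θ(p) = arccos(-p/√(1+p²))`, then there are constants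
`c₁, c₂, c₃ > 0` with `c₁/(1+p²) ≤ √(1+p²) W''(p) ≤ c₂/(1+p²)` and
`√(1+p²) |W'''(p)| ≤ c₃/(1+p²)^{3/2}` for all `p`. -/
theorem growth_conditions_strict_stability (f θ W : ℝ → ℝ) (hf : ContDiff ℝ 3 f)
    (hstab : ∀ x ∈ Set.Icc (0 : ℝ) Real.pi, 0 < f x + iteratedDeriv 2 f x)
    (hθ : ∀ p : ℝ, θ p = Real.arccos (-p / Real.sqrt (1 + p ^ 2)))
    (hW : ∀ p : ℝ, W p = Real.sqrt (1 + p ^ 2) * f (θ p)) :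
    ∃ c₁ : ℝ, 0 < c₁ ∧ ∃ c₂ : ℝ, 0 < c₂ ∧ ∃ c₃ : ℝ, 0 < c₃ ∧ ∀ p : ℝ,
      c₁ / (1 + p ^ 2) ≤ Real.sqrt (1 + p ^ 2) * iteratedDeriv 2 W p ∧
      Real.sqrt (1 + p ^ 2) * iteratedDeriv 2 W p ≤ c₂ / (1 + p ^ 2) ∧
      Real.sqrt (1 + p ^ 2) * |iteratedDeriv 3 W p| ≤ c₃ / (1 + p ^ 2) ^ ((3 : ℝ) / 2) := by
  have hf_deriv : ∀ k < 3, ∀ x, HasDerivAt (iteratedDeriv k f) (iteratedDeriv (k + 1) f x) x := by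
    intro k hk x
    rw [iteratedDeriv_succ]
    exact ((hf.differentiable_iteratedDeriv k (by exact_mod_cast hk)) x).hasDerivAt
  have hf_cont : ∀ k ≤ 3, Continuous (iteratedDeriv k f) := fun k hk =>
    hf.continuous_iteratedDeriv k (by exact_mod_cast hk)
  set s : ℝ → ℝ := fun x => Real.sqrt (1 + x ^ 2) with hs
  set t : ℝ → ℝ := fun x => Real.arctan x + Real.pi / 2 with ht
  have s_pos : ∀ p, 0 < s p := fun p => Real.sqrt_pos.2 (by positivity)
  have s_sq : ∀ p, s p ^ 2 = 1 + p ^ 2 := fun p => Real.sq_sqrt (by positivity)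
  have s_deriv : ∀ p, HasDerivAt s (p / s p) p := hasDerivAt_sqrt_one_add_sq
  have comp_deriv : ∀ k < 3, ∀ p, HasDerivAt (fun x => iteratedDeriv k f (t x))
      (iteratedDeriv (k + 1) f (t p) / s p ^ 2) p := fun k hk p =>
    hasDerivAt_comp_arctan_add_pi_div_two (hf_deriv k hk _)
  have W_eq : W = fun p => s p * iteratedDeriv 0 f (t p) := by
    funext p
    rw [hW, hθ, Real.arccos_neg_div_sqrt_one_add_sq, iteratedDeriv_zero]
  have W_one : iteratedDeriv 1 W =
      fun p => (p * iteratedDeriv 0 f (t p) + iteratedDeriv 1 f (t p)) / s p := by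
    rw [iteratedDeriv_one, W_eq]
    funext p
    rw [((s_deriv p).fun_mul (comp_deriv 0 (by norm_num) p)).deriv]
    have := (s_pos p).ne'
    field_simp
  have W_two : iteratedDeriv 2 W =
      fun p => (iteratedDeriv 0 f (t p) + iteratedDeriv 2 f (t p)) / s p ^ 3 := by
    rw [iteratedDeriv_succ, W_one]
    funext p
    rw [((((hasDerivAt_id' p).fun_mul (comp_deriv 0 (by norm_num) p)).fun_add
      (comp_deriv 1 (by norm_num) p)).fun_div (s_deriv p) (s_pos p).ne').deriv]
    have := (s_pos p).ne'
    field_simp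
    norm_num
    linear_combination (f (t p)) * s_sq p
  have W_three : iteratedDeriv 3 W =
      fun p => (iteratedDeriv 1 f (t p) + iteratedDeriv 3 f (t p)
        - 3 * p * (iteratedDeriv 0 f (t p) + iteratedDeriv 2 f (t p))) / s p ^ 5 := by
    rw [iteratedDeriv_succ, W_two]
    funext p
    rw [(((comp_deriv 0 (by norm_num) p).fun_add (comp_deriv 2 (by norm_num) p)).fun_div
      ((s_deriv p).fun_pow 3) (pow_ne_zero 3 (s_pos p).ne')).deriv]
    have := (s_pos p).ne'
    field_simp
    norm_num
    ring
  have t_mem : ∀ p, t p ∈ Set.Icc (0 : ℝ) Real.pi := fun p =>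
    ⟨by simp only [ht]; linarith [Real.neg_pi_div_two_lt_arctan p],
      by simp only [ht]; linarith [Real.arctan_lt_pi_div_two p]⟩
  have nonempty : (Set.Icc (0 : ℝ) Real.pi).Nonempty := Set.nonempty_Icc.2 Real.pi_pos.le
  have stiffness_cont : Continuous fun x => iteratedDeriv 0 f x + iteratedDeriv 2 f x :=
    (hf_cont 0 (by norm_num)).add (hf_cont 2 (by norm_num))
  obtain ⟨a, ha, a_min⟩ := isCompact_Icc.exists_isMinOn nonempty stiffness_cont.continuousOn
  obtain ⟨b, hb, b_max⟩ := isCompact_Icc.exists_isMaxOn nonempty stiffness_cont.continuousOn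
  obtain ⟨M, hM⟩ := isCompact_Icc.exists_bound_of_continuousOn (s := Set.Icc (0 : ℝ) Real.pi)
    ((hf_cont 1 (by norm_num)).add (hf_cont 3 (by norm_num))).continuousOn
  have stiffness_pos : ∀ x ∈ Set.Icc (0 : ℝ) Real.pi,
      0 < iteratedDeriv 0 f x + iteratedDeriv 2 f x := by
    simpa only [iteratedDeriv_zero] using hstab
  have M_nonneg : 0 ≤ M := (norm_nonneg _).trans (hM a ha)
  have b_pos := stiffness_pos b hb
  refine ⟨_, stiffness_pos a ha, _, b_pos,
    M + 3 * (iteratedDeriv 0 f b + iteratedDeriv 2 f b), by linarith, fun p => ?_⟩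
  have sp := s_pos p
  have lower := isMinOn_iff.1 a_min (t p) (t_mem p)
  have upper := isMaxOn_iff.1 b_max (t p) (t_mem p)
  have two_eq : s p * iteratedDeriv 2 W p
      = (iteratedDeriv 0 f (t p) + iteratedDeriv 2 f (t p)) / (1 + p ^ 2) := by
    rw [W_two, ← s_sq p]
    field_simp
  refine ⟨?_, ?_, ?_⟩
  · change _ ≤ s p * _
    rw [two_eq]
    gcongr
  · change s p * _ ≤ _
    rw [two_eq]
    gcongr
  · change s p * _ ≤ _
    have rpow_eq : (1 + p ^ 2) ^ ((3 : ℝ) / 2) = s p ^ 3 := by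
      rw [Real.rpow_div_two_eq_sqrt _ (by positivity)]
      exact_mod_cast Real.rpow_natCast (s p) 3
    have p_le : |p| ≤ s p := Real.abs_le_sqrt (by linarith)
    have one_le : 1 ≤ s p := Real.one_le_sqrt.2 (by nlinarith [sq_nonneg p])
    have hMp : |iteratedDeriv 1 f (t p) + iteratedDeriv 3 f (t p)| ≤ M := hM (t p) (t_mem p)
    have numerator_le : |iteratedDeriv 1 f (t p) + iteratedDeriv 3 f (t p)
        - 3 * p * (iteratedDeriv 0 f (t p) + iteratedDeriv 2 f (t p))|
        ≤ (M + 3 * (iteratedDeriv 0 f b + iteratedDeriv 2 f b)) * s p := by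
      refine (abs_sub _ _).trans ?_
      rw [abs_mul, abs_mul, abs_of_pos (stiffness_pos _ (t_mem p)),
        abs_of_pos (three_pos : (0 : ℝ) < 3)]
      have := mul_le_mul p_le upper (stiffness_pos _ (t_mem p)).le sp.le
      nlinarith [mul_le_mul_of_nonneg_left one_le M_nonneg]
    rw [rpow_eq, W_three]
    simp only [abs_div, abs_of_pos (pow_pos sp 5)]
    calc _ ≤ s p * ((M + 3 * (iteratedDeriv 0 f b + iteratedDeriv 2 f b)) * s p / s p ^ 5) := by
          gcongr
      _ = _ := by field_simp
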